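/- arXiv:1701.05834 — 3 statements merged into one kernel-verified Lean document; each statement's English description precedes it below -/
import Mathlib

section
/- Let E be a complex inner product space, let P, A, B be self-adjoint continuous linear endomorphisms of E with P∘A = A∘P, and let t, c be real numbers. Suppose φ, ψ ∈ E satisfy the implicit Crank–Nicolson relation ψ = φ − i·(t·A + c·B)((φ + ψ)/2). Then, writing m = (φ + ψ)/2, one has Re⟪ψ, P ψ⟫ − Re⟪φ, P φ⟫ = 2 c · Im⟪P m, B m⟫. -/
open scoped InnerProductSpace

/-- The discrete Itô-type identity for one Crank–Nicolson step of the linear scheme: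
if `ψ = φ − i(tA + cB)((φ+ψ)/2)` then, with `m = (φ+ψ)/2`,
`Re⟪ψ, Pψ⟫ − Re⟪φ, Pφ⟫ = 2c·Im⟪Pm, Bm⟫`. -/
theorem stmt_6 {E : Type*} [NormedAddCommGroup E] [InnerProductSpace ℂ E]
    (P A B : E →L[ℂ] E)
    (hP : ∀ x y : E, ⟪P x, y⟫_ℂ = ⟪x, P y⟫_ℂ)
    (hA : ∀ x y : E, ⟪A x, y⟫_ℂ = ⟪x, A y⟫_ℂ)
    (hB : ∀ x y : E, ⟪B x, y⟫_ℂ = ⟪x, B y⟫_ℂ)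
    (hPA : P ∘L A = A ∘L P)
    (t c : ℝ) (φ ψ : E)
    (hstep : ψ = φ - Complex.I •
      (((t : ℂ) • A + (c : ℂ) • B) ((2 : ℂ)⁻¹ • (φ + ψ)))) :
    (⟪ψ, P ψ⟫_ℂ).re - (⟪φ, P φ⟫_ℂ).re =
      2 * c * (⟪P ((2 : ℂ)⁻¹ • (φ + ψ)), B ((2 : ℂ)⁻¹ • (φ + ψ))⟫_ℂ).im := by
  set m : E := (2 : ℂ)⁻¹ • (φ + ψ) with hm
  set d : E := -Complex.I • ((t : ℂ) • A m + (c : ℂ) • B m) with hd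
  have hψφ : ψ = φ + d := by
    rw [hd, neg_smul, ← sub_eq_add_neg]
    exact hstep
  have hφ : φ = m - (2 : ℂ)⁻¹ • d := by
    rw [hm, hψφ]
    module
  have hψ : ψ = m + (2 : ℂ)⁻¹ • d := by
    rw [hm, hψφ]
    module
  have h_comm : P (A m) = A (P m) := DFunLike.congr_fun hPA m
  have hPA_im : (⟪P m, A m⟫_ℂ).im = 0 := by
    rw [← Complex.conj_eq_iff_im, inner_conj_symm, hA, ← h_comm, hP]
  have h_symm : (⟪d, P m⟫_ℂ).re = (⟪P m, d⟫_ℂ).re := by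
    rw [← inner_conj_symm, Complex.conj_re]
  have h_diff : (⟪ψ, P ψ⟫_ℂ).re - (⟪φ, P φ⟫_ℂ).re = 2 * (⟪P m, d⟫_ℂ).re := by
    rw [← Complex.sub_re]
    have h : ⟪ψ, P ψ⟫_ℂ - ⟪φ, P φ⟫_ℂ = ⟪P m, d⟫_ℂ + ⟪d, P m⟫_ℂ := by
      rw [hψ, hφ, hP m d]
      simp only [map_add, map_sub, map_smul, inner_add_left, inner_add_right, inner_sub_left,
        inner_sub_right, inner_smul_left, inner_smul_right, map_inv₀, map_ofNat]
      ring
    rw [h, Complex.add_re, h_symm]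
    ring
  rw [h_diff, hd, inner_smul_right, inner_add_right, inner_smul_right, inner_smul_right]
  simp [hPA_im]
  ring
end

section
/- Let E be a complex inner product space, let P, A, B be self-adjoint continuous linear endomorphisms of E with P∘A = A∘P and with P nonnegative (Re⟪v, P v⟫ ≥ 0 for all v). Let C ≥ 0 be such that |Im⟪P v, B v⟫| ≤ C · Re⟪v, P v⟫ for every v ∈ E. Let t, c be real numbers with |c| · C ≤ 1/3, and suppose φ, ψ ∈ E satisfy ψ = φ − i·(t·A + c·B)((φ + ψ)/2). Then Re⟪ψ, P ψ⟫ ≤ 2 · Re⟪φ, P φ⟫. -/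
open scoped InnerProductSpace

section SymmetricForm

variable {E : Type*} [NormedAddCommGroup E] [InnerProductSpace ℂ E]

/-- For commuting symmetric operators `P` and `A`, the number `⟪P v, A v⟫` is real. -/
theorem im_inner_eq_zero_of_commute {P A : E →L[ℂ] E}
    (hP : ∀ x y : E, ⟪P x, y⟫_ℂ = ⟪x, P y⟫_ℂ)
    (hA : ∀ x y : E, ⟪A x, y⟫_ℂ = ⟪x, A y⟫_ℂ)
    (hPA : P ∘L A = A ∘L P) (v : E) : (⟪P v, A v⟫_ℂ).im = 0 := by
  have hv : P (A v) = A (P v) := DFunLike.congr_fun hPA v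
  have h : ⟪P v, A v⟫_ℂ = ⟪A v, P v⟫_ℂ := by rw [hP, hv, ← hA]
  have h' : (⟪A v, P v⟫_ℂ).im = -(⟪P v, A v⟫_ℂ).im := by
    rw [← inner_conj_symm, Complex.conj_im]
  rw [← h] at h'
  linarith

/-- Difference of the values of a symmetric quadratic form at two points, factored. -/
theorem re_inner_map_add_sub {P : E →L[ℂ] E}
    (hP : ∀ x y : E, ⟪P x, y⟫_ℂ = ⟪x, P y⟫_ℂ) (x y : E) :
    (⟪P (x + y), y - x⟫_ℂ).re = (⟪y, P y⟫_ℂ).re - (⟪x, P x⟫_ℂ).re := by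
  have h : (⟪y, P x⟫_ℂ).re = (⟪x, P y⟫_ℂ).re := by
    rw [← hP, ← inner_conj_symm, Complex.conj_re]
  simp only [hP, map_add, inner_add_left, inner_sub_right,
    Complex.add_re, Complex.sub_re]
  linarith

/-- Midpoint convexity of a nonnegative quadratic form. -/
theorem re_inner_midpoint_le {P : E →L[ℂ] E}
    (hPpos : ∀ v : E, 0 ≤ (⟪v, P v⟫_ℂ).re) (x y : E) :
    (⟪(2 : ℂ)⁻¹ • (x + y), P ((2 : ℂ)⁻¹ • (x + y))⟫_ℂ).re ≤
      ((⟪x, P x⟫_ℂ).re + (⟪y, P y⟫_ℂ).re) / 2 := by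
  have h := hPpos (x - y)
  have hs : (⟪(2 : ℂ)⁻¹ • (x + y), P ((2 : ℂ)⁻¹ • (x + y))⟫_ℂ).re =
      (⟪x + y, P (x + y)⟫_ℂ).re / 4 := by
    rw [map_smul, inner_smul_left, inner_smul_right, ← mul_assoc]
    have : (starRingEnd ℂ) (2 : ℂ)⁻¹ * (2 : ℂ)⁻¹ = ((1 / 4 : ℝ) : ℂ) := by
      rw [map_inv₀, Complex.conj_ofNat]
      push_cast
      norm_num
    rw [this, Complex.re_ofReal_mul]
    ring
  rw [hs]
  simp only [map_add, map_sub, inner_add_left, inner_sub_left, inner_sub_right, inner_add_right,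
    Complex.add_re, Complex.sub_re] at h ⊢
  linarith

end SymmetricForm

/-- Abstract form of Lemma 3.1 (Crank–Nicolson propagator step): under the
commutator-type bound and the truncation `|c|·C ≤ 1/3`, one step at most
doubles the quadratic quantity `Re⟪·, P ·⟫`. -/
theorem stmt_7 {E : Type*} [NormedAddCommGroup E] [InnerProductSpace ℂ E]
    (P A B : E →L[ℂ] E)
    (hP : ∀ x y : E, ⟪P x, y⟫_ℂ = ⟪x, P y⟫_ℂ)
    (hA : ∀ x y : E, ⟪A x, y⟫_ℂ = ⟪x, A y⟫_ℂ)
    (hB : ∀ x y : E, ⟪B x, y⟫_ℂ = ⟪x, B y⟫_ℂ)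
    (hPA : P ∘L A = A ∘L P)
    (hPpos : ∀ v : E, 0 ≤ (⟪v, P v⟫_ℂ).re)
    (C : ℝ) (hC : 0 ≤ C)
    (hcomm : ∀ v : E, |(⟪P v, B v⟫_ℂ).im| ≤ C * (⟪v, P v⟫_ℂ).re)
    (t c : ℝ) (hc : |c| * C ≤ 1 / 3)
    (φ ψ : E)
    (hstep : ψ = φ - Complex.I •
      (((t : ℂ) • A + (c : ℂ) • B) ((2 : ℂ)⁻¹ • (φ + ψ)))) :
    (⟪ψ, P ψ⟫_ℂ).re ≤ 2 * (⟪φ, P φ⟫_ℂ).re := by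
  set m : E := (2 : ℂ)⁻¹ • (φ + ψ) with hm
  have hsum : φ + ψ = (2 : ℂ) • m := by
    rw [hm, smul_smul]
    norm_num
  have hdiff : ψ - φ = -(Complex.I • ((t : ℂ) • A m + (c : ℂ) • B m)) := by
    rw [sub_eq_iff_eq_add, neg_add_eq_sub]
    exact hstep
  have hq := re_inner_map_add_sub hP φ ψ
  have him := im_inner_eq_zero_of_commute hP hA hPA m
  have hval : (⟪P (φ + ψ), ψ - φ⟫_ℂ).re = 2 * (c * (⟪P m, B m⟫_ℂ).im) := by
    rw [hsum, hdiff, map_smul, inner_smul_left, inner_neg_right, inner_smul_right,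
      inner_add_right, inner_smul_right, inner_smul_right]
    simp [him]
  have hmid := re_inner_midpoint_le hPpos φ ψ
  rw [← hm] at hmid
  have hbound : c * (⟪P m, B m⟫_ℂ).im ≤ 1 / 3 * (⟪m, P m⟫_ℂ).re :=
    calc c * (⟪P m, B m⟫_ℂ).im ≤ |c| * |(⟪P m, B m⟫_ℂ).im| := by
          rw [← abs_mul]
          exact le_abs_self _
      _ ≤ |c| * (C * (⟪m, P m⟫_ℂ).re) := by
          gcongr
          exact hcomm m
      _ = |c| * C * (⟪m, P m⟫_ℂ).re := (mul_assoc _ _ _).symm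
      _ ≤ 1 / 3 * (⟪m, P m⟫_ℂ).re := mul_le_mul_of_nonneg_right hc (hPpos m)
  linarith
end

section
/- Let E be a complex inner product space, let P, A, B be self-adjoint continuous linear endomorphisms of E with P∘A = A∘P and with P nonnegative (Re⟪v, P v⟫ ≥ 0 for all v). Let C ≥ 0 be such that |Im⟪P v, B v⟫| ≤ C · Re⟪v, P v⟫ for every v ∈ E. Let t, c be real numbers with |c| · C ≤ 1/3, and suppose φ, ψ ∈ E satisfy ψ + i·((t/2)·A + (c/2)·B) ψ = φ. Then Re⟪ψ, P ψ⟫ ≤ 2 · Re⟪φ, P φ⟫. -/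
open scoped InnerProductSpace

/-- The quadratic form of a symmetric operator at `v + i w`. -/
lemma re_inner_add_I_smul {E : Type*} [NormedAddCommGroup E] [InnerProductSpace ℂ E]
    (P : E →L[ℂ] E) (hP : ∀ x y : E, ⟪P x, y⟫_ℂ = ⟪x, P y⟫_ℂ) (v w : E) :
    (⟪v + Complex.I • w, P (v + Complex.I • w)⟫_ℂ).re =
      (⟪v, P v⟫_ℂ).re + (⟪w, P w⟫_ℂ).re - 2 * (⟪P v, w⟫_ℂ).im := by
  have h : (⟪w, P v⟫_ℂ).im = -(⟪P v, w⟫_ℂ).im := by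
    rw [← inner_conj_symm w (P v), Complex.conj_im]
  simp only [map_add, map_smul, inner_add_left, inner_add_right, inner_smul_left,
    inner_smul_right, Complex.conj_I, ← hP v w]
  simp [h]
  ring

/-- For commuting symmetric operators `P` and `A`, the form `⟪P v, A v⟫` is real. -/
lemma im_inner_eq_zero_of_comp_comm {E : Type*} [NormedAddCommGroup E] [InnerProductSpace ℂ E]
    (P A : E →L[ℂ] E)
    (hP : ∀ x y : E, ⟪P x, y⟫_ℂ = ⟪x, P y⟫_ℂ)
    (hA : ∀ x y : E, ⟪A x, y⟫_ℂ = ⟪x, A y⟫_ℂ)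
    (hPA : P ∘L A = A ∘L P) (v : E) :
    (⟪P v, A v⟫_ℂ).im = 0 := by
  have hcomp : P (A v) = A (P v) := DFunLike.congr_fun hPA v
  have h : ⟪P v, A v⟫_ℂ = ⟪A v, P v⟫_ℂ := by
    rw [← hA, ← hcomp, hP]
  have him := congrArg Complex.im h
  rw [← inner_conj_symm (A v) (P v), Complex.conj_im] at him
  linarith

/-- Abstract form of the second estimate of Lemma 3.1 (resolvent-type step):
if `ψ + i((t/2)A + (c/2)B)ψ = φ` with the commutator bound and `|c|·C ≤ 1/3`,
then `Re⟪ψ, Pψ⟫ ≤ 2·Re⟪φ, Pφ⟫`. -/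
theorem stmt_8 {E : Type*} [NormedAddCommGroup E] [InnerProductSpace ℂ E]
    (P A B : E →L[ℂ] E)
    (hP : ∀ x y : E, ⟪P x, y⟫_ℂ = ⟪x, P y⟫_ℂ)
    (hA : ∀ x y : E, ⟪A x, y⟫_ℂ = ⟪x, A y⟫_ℂ)
    (hB : ∀ x y : E, ⟪B x, y⟫_ℂ = ⟪x, B y⟫_ℂ)
    (hPA : P ∘L A = A ∘L P)
    (hPpos : ∀ v : E, 0 ≤ (⟪v, P v⟫_ℂ).re)
    (C : ℝ) (hC : 0 ≤ C)
    (hcomm : ∀ v : E, |(⟪P v, B v⟫_ℂ).im| ≤ C * (⟪v, P v⟫_ℂ).re)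
    (t c : ℝ) (hc : |c| * C ≤ 1 / 3)
    (φ ψ : E)
    (hstep : ψ + Complex.I •
      ((((t / 2 : ℝ) : ℂ) • A + (((c / 2 : ℝ) : ℂ)) • B) ψ) = φ) :
    (⟪ψ, P ψ⟫_ℂ).re ≤ 2 * (⟪φ, P φ⟫_ℂ).re := by
  subst hstep
  rw [re_inner_add_I_smul P hP]
  set w := (((t / 2 : ℝ) : ℂ) • A + ((c / 2 : ℝ) : ℂ) • B) ψ with hw
  have him : (⟪P ψ, w⟫_ℂ).im = c / 2 * (⟪P ψ, B ψ⟫_ℂ).im := by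
    rw [hw, add_apply, smul_apply,
      smul_apply, inner_add_right, inner_smul_right, inner_smul_right,
      Complex.add_im, Complex.im_ofReal_mul, Complex.im_ofReal_mul,
      im_inner_eq_zero_of_comp_comm P A hP hA hPA, mul_zero, zero_add]
  have hbound : c * (⟪P ψ, B ψ⟫_ℂ).im ≤ 1 / 3 * (⟪ψ, P ψ⟫_ℂ).re :=
    calc c * (⟪P ψ, B ψ⟫_ℂ).im ≤ |c| * |(⟪P ψ, B ψ⟫_ℂ).im| := by
          rw [← abs_mul]
          exact le_abs_self _
      _ ≤ |c| * (C * (⟪ψ, P ψ⟫_ℂ).re) := by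
          gcongr
          exact hcomm ψ
      _ = |c| * C * (⟪ψ, P ψ⟫_ℂ).re := by ring
      _ ≤ 1 / 3 * (⟪ψ, P ψ⟫_ℂ).re := mul_le_mul_of_nonneg_right hc (hPpos ψ)
  rw [him]
  linarith [hPpos w, hPpos ψ]
end
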